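/- arXiv:0907.2230 — 3 statements merged into one kernel-verified Lean document; each statement's English description precedes it below -/
import Mathlib

section
/- Let 𝒳 be an admissible class of compact metric spaces. Then there exists a function M : [0,∞) × (0,1] → ℕ with the following property. For every X ∈ 𝒳 and every pair of unital *-representations π : C(X) → B(H_π) and ρ : C(X) → B(H_ρ) on separable complex Hilbert spaces such that π is injective and π(C(X)) ∩ K(H_π) = {0} (no nonzero element of the image of π is a compact operator), there exists a linear isometry V : H_ρ → H_π such that for every L ≥ 0, every ε ∈ (0,1], and every f ∈ C_L(X), there exists a bounded operator T on H_ρ of rank at most M(L,ε) with ‖V* π(f) V − ρ(f) − T‖ ≤ ε. -/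
open TopologicalSpace

section Operators

variable {H : Type*} [NormedAddCommGroup H] [InnerProductSpace ℂ H]

theorem norm_le_of_star_mul_self_add_eq [CompleteSpace H] {a b c : H →L[ℂ] H} {s : ℝ} (hs : 0 ≤ s)
    (h : star a * a + star b * b = ((s ^ 2 : ℝ) : ℂ) • (star c * c)) (η : H) :
    ‖a η‖ ≤ s * ‖c η‖ := by
  have key : ∀ d : H →L[ℂ] H, inner ℂ ((star d * d) η) η = ((‖d η‖ ^ 2 : ℝ) : ℂ) := fun d => by
    rw [ContinuousLinearMap.star_eq_adjoint, mul_apply_eq_comp,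
      ContinuousLinearMap.adjoint_inner_left, inner_self_eq_norm_sq_to_K]
    norm_cast
  have h1 := congrArg (fun d : H →L[ℂ] H => inner ℂ (d η) η) h
  simp only [add_apply, inner_add_left, key, smul_apply,
    inner_smul_left, Complex.conj_ofReal] at h1
  have h2 : ‖a η‖ ^ 2 + ‖b η‖ ^ 2 = s ^ 2 * ‖c η‖ ^ 2 := by exact_mod_cast h1
  refine le_of_sq_le_sq ?_ (by positivity)
  nlinarith [sq_nonneg ‖b η‖]

theorem commute_starProjection [CompleteSpace H] (K : Submodule ℂ H)
    [K.HasOrthogonalProjection] {A : H →L[ℂ] H}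
    (hA : ∀ x ∈ K, A x ∈ K) (hA' : ∀ x ∈ K, (star A) x ∈ K) : Commute A K.starProjection := by
  have hP : star K.starProjection = K.starProjection := isSelfAdjoint_starProjection K
  have h1 : ∀ B : H →L[ℂ] H, (∀ x ∈ K, B x ∈ K) →
      K.starProjection * B * K.starProjection = B * K.starProjection := fun B hB => by
    ext x
    simp only [mul_apply_eq_comp]
    exact Submodule.starProjection_eq_self_iff.2 (hB _ (K.starProjection_apply_mem x))
  have h2 := congrArg star (h1 _ hA')
  simp only [star_mul, star_star, hP] at h2
  rw [Commute, SemiconjBy, ← h2, ← mul_assoc, h1 A hA]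

theorem norm_sum_sq_eq_of_inner_eq_zero {α E : Type*} [NormedAddCommGroup E] [InnerProductSpace ℂ E]
    (s : Finset α) (v : α → E) (hv : ∀ a ∈ s, ∀ b ∈ s, a ≠ b → inner ℂ (v a) (v b) = 0) :
    ‖∑ a ∈ s, v a‖ ^ 2 = ∑ a ∈ s, ‖v a‖ ^ 2 := by
  classical
  induction s using Finset.induction_on with
  | empty => simp
  | insert a s ha ih =>
    rw [Finset.sum_insert ha, Finset.sum_insert ha,
      ← ih fun b hb c hc => hv b (Finset.mem_insert_of_mem hb) c (Finset.mem_insert_of_mem hc)]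
    have h0 : inner ℂ (v a) (∑ b ∈ s, v b) = 0 := by
      rw [inner_sum]
      refine Finset.sum_eq_zero fun b hb => hv a (Finset.mem_insert_self a s) b
        (Finset.mem_insert_of_mem hb) ?_
      rintro rfl
      exact ha hb
    have := norm_add_sq_eq_norm_sq_add_norm_sq_of_inner_eq_zero _ _ h0
    nlinarith

theorem commute_of_mem_adjoin {A : Type*} [Ring A] [Algebra ℂ A] {t : Set A} {a b : A}
    (h : ∀ c ∈ t, Commute a c) (hb : b ∈ Algebra.adjoin ℂ t) : Commute a b := by
  have : Algebra.adjoin ℂ t ≤ Subalgebra.centralizer ℂ {a} := by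
    rw [Algebra.adjoin_le_iff]
    intro c hc
    rw [SetLike.mem_coe, Subalgebra.mem_centralizer_iff]
    rintro _ rfl
    exact h c hc
  exact (Subalgebra.mem_centralizer_iff ℂ).1 (this hb) _ rfl

/-- Disjointification of finitely many commuting projections. -/
theorem exists_disjointification {A α : Type*} [Ring A] [Algebra ℂ A] [StarRing A] (E : α → A)
    (hsa : ∀ a, IsSelfAdjoint (E a)) (hid : ∀ a, IsIdempotentElem (E a))
    (hc : ∀ a b, Commute (E a) (E b)) (s : Finset α) :
    ∃ G : α → A, (∀ a ∈ s, G a ∈ Algebra.adjoin ℂ (E '' s)) ∧ (∀ a ∈ s, IsSelfAdjoint (G a)) ∧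
      (∀ a ∈ s, E a * G a = G a) ∧ (∀ a ∈ s, ∀ b ∈ s, a ≠ b → G a * G b = 0) ∧
      ∀ a ∈ s, E a * ∑ b ∈ s, G b = E a := by
  classical
  induction s using Finset.induction_on with
  | empty => exact ⟨E, by simp⟩
  | insert a s ha ih =>
    obtain ⟨G, hG, hGsa, hEG, hGG, hE⟩ := ih
    have hcE : ∀ b ∈ Algebra.adjoin ℂ (E '' s), Commute (E a) b := fun b =>
      commute_of_mem_adjoin (by rintro _ ⟨c, -, rfl⟩; exact hc a c)
    set S := ∑ b ∈ s, G b with hS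
    have hSmem : S ∈ Algebra.adjoin ℂ (E '' s) := sum_mem hG
    have hSsa : IsSelfAdjoint S := by
      rw [IsSelfAdjoint, hS, star_sum]
      exact Finset.sum_congr rfl fun b hb => hGsa b hb
    have hcS : Commute (E a) S := hcE S hSmem
    have hcG : ∀ b ∈ s, Commute (E a) (G b) := fun b hb => hcE _ (hG b hb)
    have hne : ∀ b ∈ s, b ≠ a := fun b hb h => ha (h ▸ hb)
    have hmono : Algebra.adjoin ℂ (E '' s) ≤ Algebra.adjoin ℂ (E '' (insert a s : Finset α)) :=
      Algebra.adjoin_mono (Set.image_mono (by simp))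
    have hGid : ∀ b ∈ s, G b * S = G b ∧ S * G b = G b := fun b hb => by
      have h1 : S * G b = G b * G b := by
        rw [hS, Finset.sum_mul]
        exact Finset.sum_eq_single b (fun c hc hcb => hGG c hc b hb hcb) fun h => absurd hb h
      have h2 : G b * S = G b * G b := by
        rw [hS, Finset.mul_sum]
        exact Finset.sum_eq_single b (fun c hc hcb => hGG b hb c hc hcb.symm) fun h => absurd hb h
      have h3 : S * G b = G b := by
        have h4 : G b * S = G b := by
          have h5 : G b * E b = G b := by
            have := congrArg star (hEG b hb)
            rwa [star_mul, (hsa b).star_eq, (hGsa b hb).star_eq] at this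
          rw [← h5, mul_assoc, hE b hb]
        rw [h1, ← h2, h4]
      exact ⟨by rw [h2, ← h1, h3], h3⟩
    refine ⟨fun b => if b = a then E a * (1 - S) else G b, ?_, ?_, ?_, ?_, ?_⟩
    · intro b hb
      dsimp only
      split_ifs with h
      · exact mul_mem (Algebra.subset_adjoin ⟨a, by simp, rfl⟩) (sub_mem (one_mem _) (hmono hSmem))
      · exact hmono (hG b ((Finset.mem_insert.1 hb).resolve_left h))
    · intro b hb
      dsimp only
      split_ifs with h
      · have : Commute (E a) (1 - S) := (Commute.one_right _).sub_right hcS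
        rw [IsSelfAdjoint, star_mul, star_sub, star_one, (hsa a).star_eq, hSsa.star_eq, this.eq]
      · exact hGsa b ((Finset.mem_insert.1 hb).resolve_left h)
    · intro b hb
      dsimp only
      split_ifs with h
      · rw [h, ← mul_assoc, (hid a).eq]
      · exact hEG b ((Finset.mem_insert.1 hb).resolve_left h)
    · intro b hb c hc hbc
      rcases Finset.mem_insert.1 hb with rfl | hb'
      · have hc := (Finset.mem_insert.1 hc).resolve_left (Ne.symm hbc)
        simp only [if_true, if_neg (hne c hc)]
        rw [mul_assoc, sub_mul, one_mul, (hGid c hc).2, sub_self, mul_zero]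
      · rcases Finset.mem_insert.1 hc with rfl | hc'
        · simp only [if_true, if_neg (hne b hb')]
          rw [← mul_assoc, ← (hcG b hb').eq, mul_assoc, mul_sub, mul_one, (hGid b hb').1, sub_self,
            mul_zero]
        · simp only [if_neg (hne b hb'), if_neg (hne c hc')]
          exact hGG b hb' c hc' hbc
    · have hsum : ∑ b ∈ insert a s, (if b = a then E a * (1 - S) else G b) = E a * (1 - S) + S := by
        rw [Finset.sum_insert ha, if_pos rfl, hS]
        exact congrArg _ (Finset.sum_congr rfl fun b hb => if_neg (hne b hb))
      intro b hb
      rw [hsum]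
      rcases Finset.mem_insert.1 hb with rfl | hb
      · rw [mul_add, ← mul_assoc, (hid b).eq]; noncomm_ring
      · rw [mul_add, hE b hb, ← mul_assoc, (hc b a).eq, mul_assoc, mul_sub, mul_one, hE b hb,
          sub_self, mul_zero, zero_add]

theorem mem_of_mem_adjoin {t : Set (H →L[ℂ] H)} {Z : Submodule ℂ H}
    (h : ∀ A ∈ t, ∀ x ∈ Z, A x ∈ Z) {B : H →L[ℂ] H} (hB : B ∈ Algebra.adjoin ℂ t) :
    ∀ x ∈ Z, B x ∈ Z := by
  induction hB using Algebra.adjoin_induction with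
  | mem A hA => exact h A hA
  | algebraMap r =>
    intro x hx
    simpa [Algebra.algebraMap_eq_smul_one] using Z.smul_mem r hx
  | add A B _ _ hA hB => exact fun x hx => Z.add_mem (hA x hx) (hB x hx)
  | mul A B _ _ hA hB => exact fun x hx => hA _ (hB x hx)

/-- A finite-dimensional subspace enlarges to one that is invariant under finitely many commuting
idempotents, with control of the dimension. -/
theorem exists_invariant_finrank_le {α : Type*} (E : α → H →L[ℂ] H)
    (hid : ∀ a, IsIdempotentElem (E a)) (hc : ∀ a b, Commute (E a) (E b)) (s : Finset α)
    (W : Submodule ℂ H) : ∃ W' : Submodule ℂ H, W ≤ W' ∧ (∀ a ∈ s, ∀ x ∈ W', E a x ∈ W') ∧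
      (FiniteDimensional ℂ W → FiniteDimensional ℂ W' ∧
        Module.finrank ℂ W' ≤ 2 ^ s.card * Module.finrank ℂ W) := by
  classical
  induction s using Finset.induction_on with
  | empty => exact ⟨W, le_rfl, by simp, fun h => ⟨h, by simp⟩⟩
  | insert a s ha ih =>
    obtain ⟨U, hWU, hU, hfin⟩ := ih
    refine ⟨U ⊔ U.map (E a : H →ₗ[ℂ] H), hWU.trans le_sup_left, ?_, ?_⟩
    · intro b hb x hx
      obtain ⟨u, hu, _, ⟨v, hv, rfl⟩, rfl⟩ := Submodule.mem_sup.1 hx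
      have hEv : ∀ w ∈ U, (E a) w ∈ U ⊔ U.map (E a : H →ₗ[ℂ] H) := fun w hw =>
        Submodule.mem_sup_right ⟨w, hw, rfl⟩
      rw [map_add]
      rcases Finset.mem_insert.1 hb with rfl | hb
      · refine Submodule.add_mem _ (hEv u hu) ?_
        have : (E b) (E b v) = E b v := congrArg (fun T : H →L[ℂ] H => T v) (hid b).eq
        simpa [this] using hEv v hv
      · refine Submodule.add_mem _ (Submodule.mem_sup_left (hU b hb u hu)) ?_
        have : (E b) (E a v) = E a (E b v) := congrArg (fun T : H →L[ℂ] H => T v) (hc b a).eq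
        simpa [this] using hEv _ (hU b hb v hv)
    · intro h
      obtain ⟨h1, h2⟩ := hfin h
      refine ⟨inferInstance, (Submodule.finrank_add_le_finrank_add_finrank _ _).trans ?_⟩
      have h3 := Submodule.finrank_map_le (E a : H →ₗ[ℂ] H) U
      rw [Finset.card_insert_of_notMem ha, pow_succ]
      linarith

end Operators

section Representations

variable {X : Type*} [MetricSpace X]

/-- The tent function of radius `r` centred at `y`. -/
noncomputable def tent (y : X) (r : ℝ) : C(X, ℂ) :=
  ⟨fun x => ((max 0 (r - dist x y) : ℝ) : ℂ), by fun_prop⟩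

theorem star_tent (y : X) (r : ℝ) : star (tent y r) = tent y r := by
  ext x
  simp [tent]

theorem dist_lt_of_tent_ne_zero {x y : X} {r : ℝ} (h : tent y r x ≠ 0) : dist x y < r := by
  contrapose! h
  simp [tent, h]

/-- The closure of the range of an operator. -/
abbrev closedRange {H : Type*} [NormedAddCommGroup H] [InnerProductSpace ℂ H] (T : H →L[ℂ] H) :
    Submodule ℂ H :=
  (LinearMap.range (T : H →ₗ[ℂ] H)).topologicalClosure

variable {H : Type*} [NormedAddCommGroup H] [InnerProductSpace ℂ H]
  [CompleteSpace H] (φ : C(X, ℂ) →⋆ₐ[ℂ] (H →L[ℂ] H))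

theorem norm_map_sub_smul_le {f g : C(X, ℂ)} {c : ℂ} {s : ℝ} (hs : 0 ≤ s)
    (h : ∀ x, g x ≠ 0 → ‖f x - c‖ ≤ s) {ξ : H} (hξ : ξ ∈ closedRange (φ g)) :
    ‖φ f ξ - c • ξ‖ ≤ s * ‖ξ‖ := by
  let k : C(X, ℂ) := ⟨fun x => ((Real.sqrt (s ^ 2 - ‖f x - c‖ ^ 2) : ℝ) : ℂ), by fun_prop⟩
  let u : C(X, ℂ) := (f - algebraMap ℂ _ c) * g
  have hid : star u * u + star (k * g) * (k * g) = ((s ^ 2 : ℝ) : ℂ) • (star g * g) := by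
    ext x
    by_cases hx : g x = 0
    · simp [u, hx]
    have h1 : star (f x - c) * (f x - c) = ((‖f x - c‖ ^ 2 : ℝ) : ℂ) := by
      rw [Complex.star_def, ← Complex.normSq_eq_conj_mul_self, Complex.normSq_eq_norm_sq]
    have h2 : star (k x) * k x = ((s ^ 2 - ‖f x - c‖ ^ 2 : ℝ) : ℂ) := by
      have : 0 ≤ s ^ 2 - ‖f x - c‖ ^ 2 :=
        sub_nonneg.2 (pow_le_pow_left₀ (norm_nonneg _) (h x hx) 2)
      simp only [k, ContinuousMap.coe_mk, Complex.star_def, Complex.conj_ofReal]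
      rw [← Complex.ofReal_mul, Real.mul_self_sqrt this]
    have h3 : (star u * u + star (k * g) * (k * g)) x =
        (star (f x - c) * (f x - c) + star (k x) * k x) * (star (g x) * g x) := by
      simp [u]
      ring
    rw [h3, h1, h2, ← Complex.ofReal_add]
    simp
  have key : ∀ η, ‖φ f (φ g η) - c • φ g η‖ ≤ s * ‖φ g η‖ := fun η => by
    have := norm_le_of_star_mul_self_add_eq (a := φ u) (b := φ (k * g)) (c := φ g) hs
      (by rw [← map_star, ← map_star, ← map_star, ← map_mul, ← map_mul, ← map_mul, ← map_add,
        ← map_smul, hid]) η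
    simpa [u, Algebra.algebraMap_eq_smul_one, mul_apply_eq_comp] using this
  have hcl : IsClosed {ξ : H | ‖φ f ξ - c • ξ‖ ≤ s * ‖ξ‖} :=
    isClosed_le (by fun_prop) (by fun_prop)
  refine closure_minimal ?_ hcl hξ
  rintro _ ⟨η, rfl⟩
  exact key η

theorem norm_map_sub_smul_le_of_lipschitz {f : C(X, ℂ)} {L r : ℝ} (hL : 0 ≤ L) (hr : 0 ≤ r)
    (hf : ∀ x y : X, dist (f x) (f y) ≤ L * dist x y) {y : X} {ξ : H}
    (hξ : ξ ∈ closedRange (φ (tent y r))) : ‖φ f ξ - f y • ξ‖ ≤ L * r * ‖ξ‖ := by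
  refine norm_map_sub_smul_le φ (by positivity) (fun x hx => ?_) hξ
  rw [← dist_eq_norm]
  exact (hf x y).trans (mul_le_mul_of_nonneg_left (dist_lt_of_tent_ne_zero hx).le hL)

/-- The spectral projection of `φ` for the open ball of radius `r` around `y`. -/
noncomputable abbrev ballProj (y : X) (r : ℝ) : H →L[ℂ] H :=
  (closedRange (φ (tent y r))).starProjection

theorem commute_ballProj {A : H →L[ℂ] H} {y : X} {r : ℝ} (h : Commute A (φ (tent y r))) :
    Commute A (ballProj φ y r) := by
  have hstar : star (φ (tent y r)) = φ (tent y r) := by rw [← map_star, star_tent]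
  have key : ∀ B : H →L[ℂ] H, Commute B (φ (tent y r)) → ∀ x ∈ closedRange (φ (tent y r)),
      B x ∈ closedRange (φ (tent y r)) := fun B hB x hx => by
    refine map_mem_closure B.continuous hx ?_
    rintro _ ⟨z, rfl⟩
    exact ⟨B z, (congrArg (fun T : H →L[ℂ] H => T z) hB.eq).symm⟩
  refine commute_starProjection _ (key A h) (key _ ?_)
  have := h.star_star
  rwa [hstar] at this

theorem commute_map_ballProj (f : C(X, ℂ)) (y : X) (r : ℝ) :
    Commute (φ f) (ballProj φ y r) :=
  commute_ballProj φ ((Commute.all f _).map φ)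

theorem commute_ballProj_ballProj (y z : X) (r t : ℝ) :
    Commute (ballProj φ y r) (ballProj φ z t) :=
  commute_ballProj φ (commute_map_ballProj φ _ y r).symm

theorem eq_zero_of_ballProj_apply_eq_zero {s : Finset X} {r : ℝ}
    (hs : ∀ x, ∃ y ∈ s, dist x y < r) {ξ : H} (hξ : ∀ y ∈ s, ballProj φ y r ξ = 0) : ξ = 0 := by
  have h1 : ∀ y ∈ s, φ (tent y r) ξ = 0 := fun y hy => by
    have h2 : ξ ∈ (closedRange (φ (tent y r)))ᗮ :=
      (Submodule.starProjection_apply_eq_zero_iff _).1 (hξ y hy)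
    have hstar : star (φ (tent y r)) = φ (tent y r) := by rw [← map_star, star_tent]
    refine ext_inner_left ℂ fun η => ?_
    rw [← hstar, ContinuousLinearMap.star_eq_adjoint, ContinuousLinearMap.adjoint_inner_right,
      inner_zero_right]
    exact h2 _ (Submodule.le_topologicalClosure _ ⟨η, rfl⟩)
  have hu : IsUnit (∑ y ∈ s, tent y r) := by
    rw [ContinuousMap.isUnit_iff_forall_ne_zero]
    intro x
    obtain ⟨y, hy, hxy⟩ := hs x
    have : (∑ y ∈ s, tent y r) x = ((∑ y ∈ s, max 0 (r - dist x y) : ℝ) : ℂ) := by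
      simp [tent]
    rw [this, Complex.ofReal_ne_zero]
    refine (Finset.sum_pos' (fun _ _ => le_max_left _ _) ⟨y, hy, ?_⟩).ne'
    exact lt_max_of_lt_right (sub_pos.2 hxy)
  obtain ⟨v, hv⟩ := hu.exists_left_inv
  have h3 := congrArg (fun T : H →L[ℂ] H => T ξ) (congrArg φ hv)
  simp only [map_mul, map_sum, map_one, mul_apply_eq_comp, one_apply_eq_self] at h3
  rw [← h3, sum_apply, Finset.sum_eq_zero h1, map_zero]

theorem exists_linearIsometry_mem {Z E : Type*} [NormedAddCommGroup Z] [InnerProductSpace ℂ Z]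
    [FiniteDimensional ℂ Z] [NormedAddCommGroup E] [InnerProductSpace ℂ E] {S : Submodule ℂ E}
    (hS : ¬ FiniteDimensional ℂ S) : ∃ U : Z →ₗᵢ[ℂ] E, ∀ z, U z ∈ S := by
  have hrank : (Module.finrank ℂ Z : Cardinal) ≤ Module.rank ℂ S := by
    refine le_trans ?_ (not_lt.1 fun h => hS (Module.rank_lt_aleph0_iff.1 h))
    exact Cardinal.natCast_le_aleph0
  obtain ⟨t, ht, hli⟩ := exists_finset_linearIndependent_of_le_rank hrank
  let S' : Submodule ℂ S := Submodule.span ℂ (t : Set S)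
  have hfin : FiniteDimensional ℂ S' := FiniteDimensional.span_finset ℂ t
  have hdim : Module.finrank ℂ Z = Module.finrank ℂ S' := by
    rw [← ht]
    exact (finrank_span_finset_eq_card hli).symm
  let e : Z ≃ₗᵢ[ℂ] S' := (stdOrthonormalBasis ℂ Z).equiv (stdOrthonormalBasis ℂ S') (finCongr hdim)
  exact ⟨S.subtypeₗᵢ.comp (S'.subtypeₗᵢ.comp e.toLinearIsometry), fun z => (e z : S).2⟩

omit [CompleteSpace H] in
theorem not_finiteDimensional_range_inf_orthogonal {T : H →L[ℂ] H} (hT : ¬ IsCompactOperator T)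
    (F : Submodule ℂ H) [FiniteDimensional ℂ F] :
    ¬ FiniteDimensional ℂ (LinearMap.range (T : H →ₗ[ℂ] H) ⊓ Fᗮ : Submodule ℂ H) := by
  intro h
  apply hT
  have hfg : (LinearMap.range (T : H →ₗ[ℂ] H)).FG := by
    refine Submodule.fg_of_fg_map_of_fg_inf_ker (F.starProjection : H →ₗ[ℂ] H) ?_ ?_
    · refine Module.Finite.iff_fg.1 (Submodule.finiteDimensional_of_le (S₂ := F) ?_)
      rintro _ ⟨x, -, rfl⟩
      exact F.starProjection_apply_mem x
    · rw [Submodule.ker_starProjection]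
      exact Module.Finite.iff_fg.1 h
  have : FiniteDimensional ℂ (LinearMap.range (T : H →ₗ[ℂ] H)) := Module.Finite.iff_fg.2 hfg
  have : ProperSpace (LinearMap.range (T : H →ₗ[ℂ] H)) := FiniteDimensional.proper ℂ _
  have h2 : IsCompactOperator (T.codRestrict (LinearMap.range (T : H →ₗ[ℂ] H)) fun x => ⟨x, rfl⟩) :=
    isCompactOperator_of_locallyCompactSpace_dom _
  exact h2.clm_comp (Submodule.subtypeL _)

end Representations

section Blocks

variable {X : Type*} [MetricSpace X] {H : Type*} [NormedAddCommGroup H] [InnerProductSpace ℂ H]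
  [CompleteSpace H] {π : C(X, ℂ) →⋆ₐ[ℂ] (H →L[ℂ] H)}
  {Z : Type*} [NormedAddCommGroup Z] [InnerProductSpace ℂ Z] [FiniteDimensional ℂ Z]

theorem exists_orthogonal_linearIsometries (hπ : Function.Injective π)
    (hK : ∀ f : C(X, ℂ), IsCompactOperator (π f) → π f = 0) (s : Finset X) {r : ℝ} (hr : 0 < r)
    (F : Submodule ℂ H) [FiniteDimensional ℂ F] :
    ∃ U : X → (Z →ₗᵢ[ℂ] H), (∀ a ∈ s, ∀ z, U a z ∈ Fᗮ) ∧
      (∀ a ∈ s, ∀ z, U a z ∈ closedRange (π (tent a r))) ∧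
      ∀ a ∈ s, ∀ b ∈ s, a ≠ b → ∀ z w, inner ℂ (U a z) (U b w) = 0 := by
  classical
  have hex : ∀ (a : X) (F : Submodule ℂ H) [FiniteDimensional ℂ F], ∃ U : Z →ₗᵢ[ℂ] H,
      ∀ z, U z ∈ (LinearMap.range (π (tent a r) : H →ₗ[ℂ] H) ⊓ Fᗮ : Submodule ℂ H) := by
    intro a F _
    refine exists_linearIsometry_mem (not_finiteDimensional_range_inf_orthogonal ?_ F)
    intro hc
    have h0 : tent a r = 0 := hπ ((hK _ hc).trans (map_zero π).symm)
    have h1 := congrArg (fun f : C(X, ℂ) => f a) h0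
    simp [tent, hr.le, hr.ne'] at h1
  induction s using Finset.induction_on generalizing F with
  | empty =>
    rcases isEmpty_or_nonempty X with hX | ⟨⟨a⟩⟩
    · exact ⟨fun a => hX.elim a, by simp⟩
    · exact ⟨fun _ => (hex a F).choose, by simp⟩
  | insert a s ha ih =>
    obtain ⟨V, hV⟩ := hex a F
    obtain ⟨U, hUF, hUr, hUU⟩ := ih (F ⊔ LinearMap.range V.toLinearMap)
    have hne : ∀ b ∈ s, b ≠ a := fun b hb h => ha (h ▸ hb)
    have hVU : ∀ b ∈ s, ∀ z w, inner ℂ (V z) (U b w) = 0 := fun b hb z w =>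
      (Submodule.mem_orthogonal _ _).1 (hUF b hb w) _ (Submodule.mem_sup_right ⟨z, rfl⟩)
    refine ⟨fun b => if b = a then V else U b, ?_, ?_, ?_⟩
    · intro b hb z
      dsimp only
      split_ifs with h
      · exact (hV z).2
      · exact Submodule.orthogonal_le le_sup_left
          (hUF b ((Finset.mem_insert.1 hb).resolve_left h) z)
    · intro b hb z
      dsimp only
      split_ifs with h
      · exact h ▸ Submodule.le_topologicalClosure _ (hV z).1
      · exact hUr b ((Finset.mem_insert.1 hb).resolve_left h) z
    · intro b hb c hc hbc z w
      rcases Finset.mem_insert.1 hb with rfl | hb'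
      · have hc := (Finset.mem_insert.1 hc).resolve_left (Ne.symm hbc)
        simp only [if_true, if_neg (hne c hc)]
        exact hVU c hc z w
      · rcases Finset.mem_insert.1 hc with rfl | hc'
        · simp only [if_true, if_neg (hne b hb')]
          exact inner_eq_zero_symm.1 (hVU b hb' w z)
        · simp only [if_neg (hne b hb'), if_neg (hne c hc')]
          exact hUU b hb' c hc' hbc z w

theorem exists_linearIsometry_intertwining_diagonal (hπ : Function.Injective π)
    (hK : ∀ f : C(X, ℂ), IsCompactOperator (π f) → π f = 0) (s : Finset X) (g : X → Z →ₗ[ℂ] Z)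
    (hsum : ∀ z, ∑ a ∈ s, g a z = z)
    (horth : ∀ a ∈ s, ∀ b ∈ s, a ≠ b → ∀ z w, inner ℂ (g a z) (g b w) = 0)
    (hzero : ∀ a ∈ s, ∀ b ∈ s, a ≠ b → ∀ z, g a (g b z) = 0) {r : ℝ} (hr : 0 < r)
    (F : Submodule ℂ H) [FiniteDimensional ℂ F] :
    ∃ V : Z →ₗᵢ[ℂ] H, (∀ z, V z ∈ Fᗮ) ∧ ∀ L : ℝ, 0 ≤ L → ∀ f : C(X, ℂ),
      (∀ x y : X, dist (f x) (f y) ≤ L * dist x y) →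
      ∀ z, ‖π f (V z) - V (∑ a ∈ s, f a • g a z)‖ ≤ L * r * ‖z‖ := by
  have hr' : 0 < r / (s.card + 1) := by positivity
  obtain ⟨U, hUF, hUr, hUU⟩ :=
    exists_orthogonal_linearIsometries (Z := Z) hπ hK s hr' F
  have hpyth : ∀ z, ∑ a ∈ s, ‖g a z‖ ^ 2 = ‖z‖ ^ 2 := fun z => by
    rw [← norm_sum_sq_eq_of_inner_eq_zero s (fun a => g a z)
      fun a ha b hb hab => horth a ha b hb hab z z, hsum]
  have hle : ∀ a ∈ s, ∀ z, ‖g a z‖ ≤ ‖z‖ := fun a ha z => by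
    refine le_of_sq_le_sq ?_ (norm_nonneg z)
    rw [← hpyth z]
    exact Finset.single_le_sum (f := fun a => ‖g a z‖ ^ 2) (fun _ _ => by positivity) ha
  have hidem : ∀ a ∈ s, ∀ z, g a (g a z) = g a z := fun a ha z => by
    conv_rhs => rw [← hsum z, map_sum]
    exact (Finset.sum_eq_single a (fun b hb hba => hzero a ha b hb hba.symm z)
      fun h => absurd ha h).symm
  let V₀ : Z →ₗ[ℂ] H := ∑ a ∈ s, (U a).toLinearMap ∘ₗ g a
  have hV₀ : ∀ z, V₀ z = ∑ a ∈ s, U a (g a z) := fun z => by simp [V₀]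
  let V : Z →ₗᵢ[ℂ] H := ⟨V₀, fun z => by
    refine (sq_eq_sq₀ (norm_nonneg _) (norm_nonneg _)).1 ?_
    rw [hV₀, norm_sum_sq_eq_of_inner_eq_zero s _ fun a ha b hb hab => hUU a ha b hb hab _ _,
      ← hpyth z]
    simp⟩
  have hV : ∀ z, V z = ∑ a ∈ s, U a (g a z) := hV₀
  refine ⟨V, fun z => ?_, fun L hL f hf z => ?_⟩
  · rw [hV]
    exact sum_mem fun a ha => hUF a ha _
  have h1 : V (∑ a ∈ s, f a • g a z) = ∑ a ∈ s, f a • U a (g a z) := by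
    rw [hV]
    refine Finset.sum_congr rfl fun a ha => ?_
    rw [map_sum, Finset.sum_eq_single a, map_smul, hidem a ha, map_smul]
    · intro b hb hba
      rw [map_smul, hzero a ha b hb hba.symm, smul_zero]
    · exact fun h => absurd ha h
  rw [h1, hV, map_sum, ← Finset.sum_sub_distrib]
  calc ‖∑ a ∈ s, (π f (U a (g a z)) - f a • U a (g a z))‖
      ≤ ∑ a ∈ s, ‖π f (U a (g a z)) - f a • U a (g a z)‖ := norm_sum_le _ _
    _ ≤ ∑ a ∈ s, L * (r / (s.card + 1)) * ‖z‖ := by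
        refine Finset.sum_le_sum fun a ha => ?_
        refine (norm_map_sub_smul_le_of_lipschitz π hL hr'.le hf (hUr a ha _)).trans ?_
        rw [LinearIsometry.norm_map]
        exact mul_le_mul_of_nonneg_left (hle a ha z) (by positivity)
    _ = L * (r * (s.card / (s.card + 1))) * ‖z‖ := by
        rw [Finset.sum_const, nsmul_eq_mul]
        ring
    _ ≤ L * r * ‖z‖ := by
        have : (s.card / (s.card + 1) : ℝ) ≤ 1 := div_le_one_of_le₀ (by linarith) (by positivity)
        gcongr
        exact mul_le_of_le_one_right hr.le this

theorem exists_linearIsometry_intertwining {K : Type*} [NormedAddCommGroup K]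
    [InnerProductSpace ℂ K] [CompleteSpace K] (ρ : C(X, ℂ) →⋆ₐ[ℂ] (K →L[ℂ] K))
    (hπ : Function.Injective π)
    (hK : ∀ f : C(X, ℂ), IsCompactOperator (π f) → π f = 0) {s : Finset X} {r : ℝ} (hr : 0 < r)
    (hs : ∀ x, ∃ y ∈ s, dist x y < r) (Z : Submodule ℂ K) [FiniteDimensional ℂ Z]
    (hZ : ∀ y ∈ s, ∀ x ∈ Z, ballProj ρ y r x ∈ Z) (F : Submodule ℂ H) [FiniteDimensional ℂ F] :
    ∃ V : Z →ₗᵢ[ℂ] H, (∀ z, V z ∈ Fᗮ) ∧ ∀ L : ℝ, 0 ≤ L → ∀ f : C(X, ℂ),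
      (∀ x y : X, dist (f x) (f y) ≤ L * dist x y) → ∀ z : Z, ∃ d : Z,
        ‖ρ f z - d‖ ≤ L * r * ‖z‖ ∧ ‖π f (V z) - V d‖ ≤ L * r * ‖z‖ := by
  classical
  obtain ⟨G, hG, hGsa, hEG, hGG, hE⟩ := exists_disjointification (fun y => ballProj ρ y r)
    (fun y => isSelfAdjoint_starProjection _) (fun y => Submodule.isIdempotentElem_starProjection _)
    (fun y z => commute_ballProj_ballProj ρ y z r r) s
  have hGZ : ∀ a ∈ s, ∀ x ∈ Z, G a x ∈ Z := fun a ha =>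
    mem_of_mem_adjoin (by rintro _ ⟨y, hy, rfl⟩; exact hZ y hy) (hG a ha)
  have hsum : ∀ x, ∑ a ∈ s, G a x = x := fun x => by
    rw [← sub_eq_zero, ← neg_eq_zero, neg_sub]
    refine eq_zero_of_ballProj_apply_eq_zero ρ hs fun y hy => ?_
    have := congrArg (fun T : K →L[ℂ] K => T x) (hE y hy)
    simp only [mul_apply_eq_comp, sum_apply] at this
    rw [map_sub, this, sub_self]
  have horth : ∀ a ∈ s, ∀ b ∈ s, a ≠ b → ∀ z w, inner ℂ (G a z) (G b w) = 0 :=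
    fun a ha b hb hab z w => by
      rw [← ContinuousLinearMap.adjoint_inner_right, ← ContinuousLinearMap.star_eq_adjoint,
        (hGsa a ha).star_eq, ← mul_apply_eq_comp, hGG a ha b hb hab, zero_apply,
        inner_zero_right]
  have hcomm : ∀ f, ∀ a ∈ s, Commute (ρ f) (G a) := fun f a ha =>
    commute_of_mem_adjoin (by rintro _ ⟨y, -, rfl⟩; exact commute_map_ballProj ρ f y r) (hG a ha)
  let g : X → Z →ₗ[ℂ] Z := fun a =>
    if ha : a ∈ s then (G a : K →ₗ[ℂ] K).restrict (hGZ a ha) else 0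
  have hg : ∀ a ∈ s, ∀ z : Z, (g a z : K) = G a z := fun a ha z => by simp [g, ha]
  obtain ⟨V, hVF, hV⟩ := exists_linearIsometry_intertwining_diagonal hπ hK s g
    (fun z => by
      ext
      rw [Submodule.coe_sum, Finset.sum_congr rfl fun a ha => hg a ha z, hsum])
    (fun a ha b hb hab z w => by
      rw [Submodule.coe_inner, hg a ha, hg b hb, horth a ha b hb hab])
    (fun a ha b hb hab z => by
      ext
      rw [hg a ha, hg b hb, ← mul_apply_eq_comp, hGG a ha b hb hab]; rfl) hr F
  refine ⟨V, hVF, fun L hL f hf z => ⟨∑ a ∈ s, f a • g a z, ?_, hV L hL f hf z⟩⟩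
  have h1 : ρ f z - ((∑ a ∈ s, f a • g a z : Z) : K) =
      ∑ a ∈ s, (ρ f (G a z) - f a • G a z) := by
    rw [Finset.sum_sub_distrib, ← map_sum, hsum, Submodule.coe_sum]
    congr 1
    exact Finset.sum_congr rfl fun a ha => by rw [Submodule.coe_smul, hg a ha]
  have h2 : ∀ a ∈ s, ρ f (G a z) - f a • G a z = G a (ρ f z - f a • (z : K)) := fun a ha => by
    rw [map_sub, map_smul, ← mul_apply_eq_comp, (hcomm f a ha).eq, mul_apply_eq_comp]
  refine le_of_sq_le_sq ?_ (by positivity)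
  rw [h1, norm_sum_sq_eq_of_inner_eq_zero]
  · calc ∑ a ∈ s, ‖ρ f (G a z) - f a • G a z‖ ^ 2
        ≤ ∑ a ∈ s, (L * r) ^ 2 * ‖G a z‖ ^ 2 := by
          refine Finset.sum_le_sum fun a ha => ?_
          rw [← mul_pow]
          refine pow_le_pow_left₀ (norm_nonneg _) ?_ 2
          refine norm_map_sub_smul_le_of_lipschitz ρ hL hr.le hf ?_
          refine Submodule.starProjection_eq_self_iff.1 ?_
          exact congrArg (fun T : K →L[ℂ] K => T z) (hEG a ha)
      _ = (L * r * ‖z‖) ^ 2 := by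
          rw [← Finset.mul_sum, ← norm_sum_sq_eq_of_inner_eq_zero s (fun a => G a (z : K))
            fun a ha b hb hab => horth a ha b hb hab z z, hsum,
            Submodule.coe_norm, mul_pow (L * r)]
  · intro a ha b hb hab
    rw [h2 a ha, h2 b hb, horth a ha b hb hab]

end Blocks

section Gluing

variable {K H : Type*} [NormedAddCommGroup K] [InnerProductSpace ℂ K] [NormedAddCommGroup H]
  [InnerProductSpace ℂ H]

/-- The successive differences of an increasing sequence of subspaces. -/
noncomputable abbrev increment (W : ℕ → Submodule ℂ K) (n : ℕ) : Submodule ℂ K :=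
  (W n)ᗮ ⊓ W (n + 1)

theorem starProjection_succ_sub_mem_increment {W : ℕ → Submodule ℂ K}
    [∀ n, FiniteDimensional ℂ (W n)] (hW : Monotone W) (n : ℕ) (ξ : K) :
    (W (n + 1)).starProjection ξ - (W n).starProjection ξ ∈ increment W n := by
  refine ⟨?_, (W (n + 1)).sub_mem (Submodule.starProjection_apply_mem _ _)
    (hW n.le_succ (Submodule.starProjection_apply_mem _ _))⟩
  have h := Submodule.sub_mem _ ((W n).sub_starProjection_mem_orthogonal ξ)
    (Submodule.orthogonal_le (hW n.le_succ) ((W (n + 1)).sub_starProjection_mem_orthogonal ξ))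
  rwa [sub_sub_sub_cancel_left] at h

/-- Isometries on the increments that can be chosen orthogonal to any given finite-dimensional
subspace can be chosen pairwise orthogonal. -/
theorem exists_orthogonalFamily {W : ℕ → Submodule ℂ K} [∀ n, FiniteDimensional ℂ (W n)]
    {P : ∀ n, (increment W n →ₗᵢ[ℂ] H) → Prop}
    (hP : ∀ n (F : Submodule ℂ H) [FiniteDimensional ℂ F], ∃ V, P n V ∧ ∀ z, V z ∈ Fᗮ) :
    ∃ V : ∀ n, increment W n →ₗᵢ[ℂ] H, (∀ n, P n (V n)) ∧
      OrthogonalFamily ℂ (fun n => increment W n) V := by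
  choose V hPV hVF using fun n (F : {F : Submodule ℂ H // FiniteDimensional ℂ F}) =>
    haveI := F.2; hP n F.1
  let F : ℕ → {F : Submodule ℂ H // FiniteDimensional ℂ F} := fun n =>
    Nat.rec ⟨⊥, inferInstance⟩ (fun n F =>
      ⟨F.1 ⊔ LinearMap.range (V n F).toLinearMap, haveI := F.2; inferInstance⟩) n
  have hF : ∀ n, (F (n + 1)).1 = (F n).1 ⊔ LinearMap.range (V n (F n)).toLinearMap :=
    fun n => rfl
  have hmono : Monotone fun n => (F n).1 :=
    monotone_nat_of_le_succ fun n => by rw [hF]; exact le_sup_left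
  have hlt : ∀ m n, m < n → ∀ v w, inner ℂ (V m (F m) v) (V n (F n) w) = 0 := by
    intro m n hmn v w
    refine (Submodule.mem_orthogonal _ _).1 (hVF n (F n) w) _ (hmono (Nat.succ_le_of_lt hmn) ?_)
    change _ ∈ (F (m + 1)).1
    rw [hF]
    exact Submodule.mem_sup_right ⟨v, rfl⟩
  refine ⟨fun n => V n (F n), fun n => hPV n _, fun m n hmn v w => ?_⟩
  rcases lt_or_gt_of_ne hmn with h | h
  · exact hlt m n h v w
  · exact inner_eq_zero_symm.1 (hlt n m h w v)

/-- Isometries with orthogonal ranges on the increments of an exhaustion glue to a global isometry. -/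
theorem exists_linearIsometry_extending [CompleteSpace K] [CompleteSpace H]
    {W : ℕ → Submodule ℂ K} [∀ n, FiniteDimensional ℂ (W n)] (hW : Monotone W) (hW0 : W 0 = ⊥)
    (hdense : ⊤ ≤ (⨆ n, W n).topologicalClosure) {V : ∀ n, increment W n →ₗᵢ[ℂ] H}
    (hV : OrthogonalFamily ℂ (fun n => increment W n) V) :
    ∃ U : K →ₗᵢ[ℂ] H, ∀ n, ∀ z : increment W n, U z = V n z := by
  classical
  have hlt : ∀ m n, m < n → ∀ (v : increment W m) (w : increment W n),
      inner ℂ (v : K) (w : K) = 0 := fun m n hmn v w =>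
    (Submodule.mem_orthogonal _ _).1 w.2.1 _ (hW (Nat.succ_le_of_lt hmn) v.2.2)
  have horth : OrthogonalFamily ℂ (fun n => increment W n) fun n => (increment W n).subtypeₗᵢ := by
    intro m n hmn v w
    rcases lt_or_gt_of_ne hmn with h | h
    · exact hlt m n h v w
    · exact inner_eq_zero_symm.1 (hlt n m h w v)
  have hle : ∀ n, W n ≤ ⨆ m, increment W m := by
    intro n
    induction n with
    | zero => simp [hW0]
    | succ n ih =>
      rw [← Submodule.sup_orthogonal_inf_of_hasOrthogonalProjection (hW n.le_succ)]
      exact sup_le ih (le_iSup (increment W) n)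
  have hsum := IsHilbertSum.mkInternal (fun n => increment W n) horth
    (hdense.trans (Submodule.topologicalClosure_mono (iSup_le hle)))
  refine ⟨hV.linearIsometry.comp hsum.linearIsometryEquiv.toLinearIsometry, fun n z => ?_⟩
  have h1 : hsum.linearIsometryEquiv (z : K) = lp.single 2 n z := by
    rw [← LinearIsometryEquiv.eq_symm_apply, hsum.linearIsometryEquiv_symm_apply_single]
    rfl
  simp [h1]

theorem norm_apply_sub_starProjection_le [CompleteSpace K] {W : ℕ → Submodule ℂ K}
    [∀ n, FiniteDimensional ℂ (W n)] (hW : Monotone W)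
    (hdense : ⊤ ≤ (⨆ n, W n).topologicalClosure) {R : K →L[ℂ] H} {c : ℝ} (hc : 0 ≤ c)
    (hR : ∀ n, ∀ z ∈ increment W n, ‖R z‖ ≤ c * (1 / 2) ^ n * ‖z‖) (N : ℕ) (ξ : K) :
    ‖R (ξ - (W N).starProjection ξ)‖ ≤ 4 * c * (1 / 2) ^ N * ‖ξ‖ := by
  have hstep : ∀ n, ‖R ((W (n + 1)).starProjection ξ - (W n).starProjection ξ)‖ ≤
      c * (1 / 2) ^ n * (2 * ‖ξ‖) := fun n => by
    refine (hR n _ (starProjection_succ_sub_mem_increment hW n ξ)).trans ?_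
    gcongr
    refine (norm_sub_le _ _).trans ?_
    have h1 := (W (n + 1)).norm_starProjection_apply_le ξ
    have h2 := (W n).norm_starProjection_apply_le ξ
    linarith
  have hfin : ∀ k, ‖R ((W (N + k)).starProjection ξ - (W N).starProjection ξ)‖ ≤
      4 * c * ((1 / 2) ^ N - (1 / 2) ^ (N + k)) * ‖ξ‖ := by
    intro k
    induction k with
    | zero => simp
    | succ k ih =>
      rw [← sub_add_sub_cancel _ ((W (N + k)).starProjection ξ), map_add]
      refine (norm_add_le _ _).trans ((add_le_add (hstep (N + k)) ih).trans_eq ?_)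
      rw [← add_assoc N, pow_succ _ (N + k)]
      ring
  have hlim : Filter.Tendsto
      (fun k => ‖R ((W (N + k)).starProjection ξ - (W N).starProjection ξ)‖) Filter.atTop
      (nhds ‖R (ξ - (W N).starProjection ξ)‖) := by
    have h := Submodule.starProjection_tendsto_self W hW ξ hdense
    have h' := (Filter.tendsto_add_atTop_iff_nat N).2 h
    simp only [add_comm _ N] at h'
    exact ((R.continuous.tendsto _).comp (h'.sub_const _)).norm
  refine le_of_tendsto' hlim fun k => (hfin k).trans ?_
  have : (0 : ℝ) ≤ (1 / 2) ^ (N + k) := by positivity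
  gcongr
  linarith

end Gluing

/-- Bound for the dimensions of the subspaces of `exists_exhaustion`. -/
def dimBound (k : ℕ → ℕ) : ℕ → ℕ
  | 0 => 0
  | n + 1 => 2 ^ (∑ m ∈ Finset.range (n + 2), k m) * (dimBound k n + 1)

theorem exists_exhaustion {α K : Type*} [NormedAddCommGroup K] [InnerProductSpace ℂ K]
    [SeparableSpace K] (E : ℕ → α → K →L[ℂ] K) (hid : ∀ n a, IsIdempotentElem (E n a))
    (hc : ∀ m n a b, Commute (E m a) (E n b)) {s : ℕ → Finset α} {k : ℕ → ℕ}
    (hs : ∀ n, (s n).card ≤ k n) :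
    ∃ W : ℕ → Submodule ℂ K, Monotone W ∧ W 0 = ⊥ ∧ ⊤ ≤ (⨆ n, W n).topologicalClosure ∧
      (∀ n, FiniteDimensional ℂ (W n) ∧ Module.finrank ℂ (W n) ≤ dimBound k n) ∧
      ∀ n, ∀ a ∈ s n, ∀ x, (x ∈ W n → E n a x ∈ W n) ∧ (x ∈ W (n + 1) → E n a x ∈ W (n + 1)) := by
  choose c hle hinv hfin using fun n => exists_invariant_finrank_le
    (fun p : Σ _ : ℕ, α => E p.1 p.2) (fun p => hid p.1 p.2) (fun p q => hc p.1 q.1 p.2 q.2)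
    ((Finset.range (n + 2)).sigma s)
  obtain ⟨W, hW0, hW⟩ : ∃ W : ℕ → Submodule ℂ K, W 0 = ⊥ ∧
      ∀ n, W (n + 1) = c n (W n ⊔ Submodule.span ℂ {denseSeq K n}) :=
    ⟨fun n => Nat.rec ⊥ (fun n U => c n (U ⊔ Submodule.span ℂ {denseSeq K n})) n, rfl, fun _ => rfl⟩
  have hsucc : ∀ n, W n ⊔ Submodule.span ℂ {denseSeq K n} ≤ W (n + 1) := fun n =>
    hW n ▸ hle n _
  have hWinv : ∀ n, ∀ m ≤ n + 1, ∀ a ∈ s m, ∀ x ∈ W (n + 1), E m a x ∈ W (n + 1) :=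
    fun n m hm a ha x hx => hW n ▸ hinv n _ ⟨m, a⟩
      (Finset.mem_sigma.2 ⟨Finset.mem_range.2 (show m < n + 2 by omega), ha⟩) x (hW n ▸ hx)
  refine ⟨W, monotone_nat_of_le_succ fun n => le_sup_left.trans (hsucc n), hW0, ?_, ?_, ?_⟩
  · intro x _
    refine closure_mono ?_ (denseRange_denseSeq K x)
    rintro _ ⟨n, rfl⟩
    exact le_iSup W (n + 1)
      (hsucc n (Submodule.mem_sup_right (Submodule.mem_span_singleton_self _)))
  · intro n
    induction n with
    | zero =>
      rw [hW0]
      exact ⟨inferInstance, (finrank_bot ℂ K).le⟩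
    | succ n ih =>
      obtain ⟨h1, h2⟩ := ih
      obtain ⟨h3, h4⟩ := hfin n (W n ⊔ Submodule.span ℂ {denseSeq K n}) inferInstance
      rw [hW]
      refine ⟨h3, h4.trans (Nat.mul_le_mul (Nat.pow_le_pow_right two_pos ?_) ?_)⟩
      · rw [Finset.card_sigma]
        exact Finset.sum_le_sum fun m _ => hs m
      · have h3 : Module.finrank ℂ (Submodule.span ℂ {denseSeq K n}) ≤ 1 := by
          simpa using finrank_span_le_card (R := ℂ) ({denseSeq K n} : Set K)
        exact (Submodule.finrank_add_le_finrank_add_finrank _ _).trans (add_le_add h2 h3)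
  · refine fun n a ha x => ⟨fun hx => ?_, hWinv n n n.le_succ a ha x⟩
    cases n with
    | zero =>
      rw [hW0, Submodule.mem_bot] at hx ⊢
      rw [hx, map_zero]
    | succ n => exact hWinv n _ le_rfl a ha x hx

theorem map_mem_increment {K : Type*} [NormedAddCommGroup K] [InnerProductSpace ℂ K]
    [CompleteSpace K] {W : ℕ → Submodule ℂ K} {n : ℕ} {A : K →L[ℂ] K} (hA : IsSelfAdjoint A)
    (h : ∀ x, (x ∈ W n → A x ∈ W n) ∧ (x ∈ W (n + 1) → A x ∈ W (n + 1))) {x : K}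
    (hx : x ∈ increment W n) : A x ∈ increment W n := by
  refine ⟨(Submodule.mem_orthogonal _ _).2 fun u hu => ?_, (h x).2 hx.2⟩
  rw [← ContinuousLinearMap.adjoint_inner_left, ← ContinuousLinearMap.star_eq_adjoint, hA.star_eq]
  exact (Submodule.mem_orthogonal _ _).1 hx.1 _ ((h u).1 hu)

/-- **Quantified Weyl–von Neumann theorem.**
Let `X i`, `i : ι`, be an admissible class of compact metric spaces (for every `ε > 0`
there is `N` such that every member has an `ε`-net of cardinality at most `N`).
Then there is a function `M : ℝ → ℝ → ℕ` such that for every member `X i` and every pair of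
unital *-representations `π, ρ` of `C(X i, ℂ)` on separable complex Hilbert spaces with `π`
injective and `π(C(X i))` meeting the compacts only in `0`, there is a linear isometry
`V : Hρ →ₗᵢ Hπ` such that for every `L ≥ 0`, `ε ∈ (0,1]` and every `L`-Lipschitz `f` with
`‖f‖_∞ ≤ 1`, the operator `V* π(f) V − ρ(f)` is within `ε` of an operator of rank
at most `M L ε`. -/
theorem quantified_weyl_von_neumann
    {ι : Type} (X : ι → Type)
    [∀ i, MetricSpace (X i)] [∀ i, CompactSpace (X i)]
    (hadm : ∀ ε : ℝ, 0 < ε → ∃ N : ℕ, ∀ i : ι,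
      ∃ E : Finset (X i), E.card ≤ N ∧ ∀ x : X i, ∃ y ∈ E, dist x y ≤ ε) :
    ∃ M : ℝ → ℝ → ℕ,
      ∀ (i : ι) (Hπ Hρ : Type)
        [NormedAddCommGroup Hπ] [InnerProductSpace ℂ Hπ] [CompleteSpace Hπ]
        [SeparableSpace Hπ]
        [NormedAddCommGroup Hρ] [InnerProductSpace ℂ Hρ] [CompleteSpace Hρ]
        [SeparableSpace Hρ]
        (π : C(X i, ℂ) →⋆ₐ[ℂ] (Hπ →L[ℂ] Hπ))
        (ρ : C(X i, ℂ) →⋆ₐ[ℂ] (Hρ →L[ℂ] Hρ)),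
        Function.Injective π →
        (∀ f : C(X i, ℂ), IsCompactOperator ⇑(π f) → π f = 0) →
        ∃ V : Hρ →ₗᵢ[ℂ] Hπ,
          ∀ (L : ℝ), 0 ≤ L → ∀ (ε : ℝ), 0 < ε → ε ≤ 1 →
            ∀ f : C(X i, ℂ),
              (∀ x y : X i, dist (f x) (f y) ≤ L * dist x y) →
              (∀ x : X i, ‖f x‖ ≤ 1) →
              ∃ T : Hρ →L[ℂ] Hρ,
                LinearMap.rank (T : Hρ →ₗ[ℂ] Hρ) ≤ (M L ε : Cardinal) ∧
                ‖(ContinuousLinearMap.adjoint V.toContinuousLinearMap).comp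
                    ((π f).comp V.toContinuousLinearMap) - ρ f - T‖ ≤ ε := by
  choose k hk using fun n : ℕ => hadm ((1 / 2) ^ n) (by positivity)
  have hN : ∀ L ε : ℝ, ∃ N : ℕ, 0 ≤ L → 0 < ε → 16 * L * (1 / 2) ^ N ≤ ε := by
    intro L ε
    by_cases h : 0 ≤ L ∧ 0 < ε
    · have hpos : 0 < 16 * L + 1 := by linarith [h.1]
      obtain ⟨N, hN⟩ := exists_pow_lt_of_lt_one (div_pos h.2 hpos)
        (by norm_num : (1 / 2 : ℝ) < 1)
      refine ⟨N, fun _ _ => ?_⟩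
      rw [lt_div_iff₀ hpos] at hN
      have : (0 : ℝ) ≤ (1 / 2) ^ N := by positivity
      nlinarith
    · exact ⟨0, fun h1 h2 => absurd ⟨h1, h2⟩ h⟩
  choose N hN using hN
  refine ⟨fun L ε => dimBound k (N L ε), ?_⟩
  intro i Hπ Hρ _ _ _ _ _ _ _ _ π ρ hπ hK
  choose s hcard hs using fun n => hk n i
  let r : ℕ → ℝ := fun n => 2 * (1 / 2) ^ n
  have hr : ∀ n, 0 < r n := fun n => by positivity
  have hs' : ∀ n x, ∃ y ∈ s n, dist x y < r n := fun n x => by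
    obtain ⟨y, hy, hxy⟩ := hs n x
    refine ⟨y, hy, hxy.trans_lt ?_⟩
    have : (0 : ℝ) < (1 / 2) ^ n := by positivity
    simp only [r]
    linarith
  obtain ⟨W, hmono, hW0, hdense, hfin, hinv⟩ := exists_exhaustion
    (fun n y => ballProj ρ y (r n)) (fun n y => Submodule.isIdempotentElem_starProjection _)
    (fun m n y z => commute_ballProj_ballProj ρ y z (r m) (r n)) hcard
  have : ∀ n, FiniteDimensional ℂ (W n) := fun n => (hfin n).1
  obtain ⟨V, hV, hVorth⟩ := exists_orthogonalFamily (W := W) (H := Hπ)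
    (P := fun n V => ∀ L : ℝ, 0 ≤ L → ∀ f : C(X i, ℂ),
      (∀ x y : X i, dist (f x) (f y) ≤ L * dist x y) → ∀ z : increment W n,
        ∃ d : increment W n, ‖ρ f z - d‖ ≤ L * r n * ‖z‖ ∧ ‖π f (V z) - V d‖ ≤ L * r n * ‖z‖)
    (fun n F _ => by
      obtain ⟨V, hVF, hV⟩ := exists_linearIsometry_intertwining ρ hπ hK (hr n) (hs' n)
        (increment W n) (fun y hy x hx => map_mem_increment (isSelfAdjoint_starProjection _)
          (hinv n y hy) hx) F
      exact ⟨V, hV, hVF⟩)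
  obtain ⟨U, hU⟩ := exists_linearIsometry_extending hmono hW0 hdense hVorth
  refine ⟨U, fun L hL ε hε _ f hf _ => ?_⟩
  let R : Hρ →L[ℂ] Hπ := (π f).comp U.toContinuousLinearMap - U.toContinuousLinearMap.comp (ρ f)
  have hR : ∀ n, ∀ z ∈ increment W n, ‖R z‖ ≤ 4 * L * (1 / 2) ^ n * ‖z‖ := by
    intro n z hz
    obtain ⟨d, hd1, hd2⟩ := hV n L hL f hf ⟨z, hz⟩
    have h1 : R z = (π f (V n ⟨z, hz⟩) - V n d) - U (ρ f z - d) := by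
      rw [map_sub, hU n d, ← hU n ⟨z, hz⟩]
      simp [R]
    rw [h1]
    refine (norm_sub_le _ _).trans ?_
    rw [LinearIsometry.norm_map]
    refine (add_le_add hd2 hd1).trans_eq ?_
    simp only [r, Submodule.coe_norm]
    ring
  let P := (W (N L ε)).starProjection
  let A := ContinuousLinearMap.adjoint U.toContinuousLinearMap
  have hAU : A.comp U.toContinuousLinearMap = 1 := U.adjoint_comp_self
  refine ⟨A.comp (R.comp P), ?_, ?_⟩
  · have h1 : LinearMap.rank (P : Hρ →ₗ[ℂ] Hρ) ≤ (dimBound k (N L ε) : Cardinal) := by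
      rw [LinearMap.rank, Submodule.range_starProjection, ← Module.finrank_eq_rank]
      exact_mod_cast (hfin (N L ε)).2
    exact (LinearMap.rank_comp_le_right (P : Hρ →ₗ[ℂ] Hρ)
      ((A.comp R : Hρ →L[ℂ] Hρ) : Hρ →ₗ[ℂ] Hρ)).trans h1
  · refine ContinuousLinearMap.opNorm_le_bound _ hε.le fun ξ => ?_
    have h1 : (A.comp ((π f).comp U.toContinuousLinearMap) - ρ f - A.comp (R.comp P)) ξ =
        A (R (ξ - P ξ)) := by
      have h2 : A (U (ρ f ξ)) = ρ f ξ := congrArg (fun T : Hρ →L[ℂ] Hρ => T (ρ f ξ)) hAU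
      rw [map_sub R, map_sub A]
      simp [R, h2]
    rw [h1]
    have hA : ‖A‖ ≤ 1 := by
      rw [LinearIsometryEquiv.norm_map]
      exact U.norm_toContinuousLinearMap_le
    calc ‖A (R (ξ - P ξ))‖ ≤ ‖R (ξ - P ξ)‖ := by
          simpa using A.le_of_opNorm_le hA (R (ξ - P ξ))
      _ ≤ 4 * (4 * L) * (1 / 2) ^ (N L ε) * ‖ξ‖ :=
          norm_apply_sub_starProjection_le hmono hdense (by positivity) hR _ ξ
      _ ≤ ε * ‖ξ‖ := by
          have := hN L ε hL hε
          gcongr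
          linarith
end

section
/- Let 𝒳 be an admissible class of compact metric spaces. Then for every L ≥ 0 and ε > 0 there exists N ∈ ℕ such that for every X ∈ 𝒳 there exists a set S of bounded Borel-measurable simple functions X → ℂ (functions with finite range and Borel-measurable level sets) with |S| ≤ N, such that every f ∈ C_L(X) satisfies ‖f − s‖_∞ ≤ ε for some s ∈ S. -/
open MeasureTheory in
/-- A metric space with a `δ`-net of at most `N` points splits into at most `N + 1` Borel pieces of
diameter at most `2 * δ`. -/
lemma exists_measurable_fin_dist_le {X : Type*} [MetricSpace X] [MeasurableSpace X] [BorelSpace X]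
    {δ : ℝ} {N : ℕ} (E : Finset X) (hN : E.card ≤ N) (hE : ∀ x, ∃ y ∈ E, dist x y ≤ δ) :
    ∃ p : X → Fin (N + 1), Measurable p ∧ ∀ x y, p x = p y → dist x y ≤ 2 * δ := by
  rcases isEmpty_or_nonempty X with hX | ⟨⟨x₀⟩⟩
  · exact ⟨fun _ => 0, measurable_const, fun x => (hX.false x).elim⟩
  let e : ℕ → X := fun k => E.toList.getD k x₀
  have hnear (x : X) : dist (SimpleFunc.nearestPt e N x) x ≤ δ := by
    obtain ⟨y, hy, hxy⟩ := hE x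
    obtain ⟨k, hk, rfl⟩ := List.getElem_of_mem (Finset.mem_toList.2 hy)
    have hkN : k ≤ N := by
      rw [Finset.length_toList] at hk
      lia
    have h := SimpleFunc.edist_nearestPt_le e x hkN
    have hek : e k = E.toList[k] := List.getD_eq_getElem _ _ hk
    rw [hek, edist_dist, edist_dist, ENNReal.ofReal_le_ofReal_iff dist_nonneg] at h
    exact h.trans (dist_comm x _ ▸ hxy)
  refine ⟨fun x => Fin.ofNat (N + 1) (SimpleFunc.nearestPtInd e N x),
    (measurable_of_countable (Fin.ofNat (N + 1))).comp (SimpleFunc.measurable _), fun x y hxy => ?_⟩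
  have hle (z : X) : SimpleFunc.nearestPtInd e N z < N + 1 :=
    Nat.lt_succ_of_le (SimpleFunc.nearestPtInd_le e N z)
  have hind : SimpleFunc.nearestPtInd e N x = SimpleFunc.nearestPtInd e N y := by
    have h := congrArg Fin.val hxy
    simpa [Fin.ofNat, Nat.mod_eq_of_lt (hle x), Nat.mod_eq_of_lt (hle y)] using h
  have hpt : SimpleFunc.nearestPt e N x = SimpleFunc.nearestPt e N y := by
    simp only [SimpleFunc.nearestPt, SimpleFunc.map_apply, hind]
  have hx := hnear x
  have hy := hnear y
  rw [← hpt] at hy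
  linarith [dist_triangle_left x y (SimpleFunc.nearestPt e N x)]

/-- For an admissible class of compact metric spaces `X i`, `i : ι`, given `L ≥ 0` and `ε > 0`
there is a uniform bound `N` such that each `C_L(X i)` (the `L`-Lipschitz functions of sup-norm
at most `1`) admits an `ε`-net of at most `N` simple Borel functions. -/
theorem nets_of_simple_functions_in_CL
    {ι : Type} (X : ι → Type)
    [∀ i, MetricSpace (X i)] [∀ i, CompactSpace (X i)]
    [∀ i, MeasurableSpace (X i)] [∀ i, BorelSpace (X i)]
    (hadm : ∀ ε : ℝ, 0 < ε → ∃ N : ℕ, ∀ i : ι,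
      ∃ E : Finset (X i), E.card ≤ N ∧ ∀ x : X i, ∃ y ∈ E, dist x y ≤ ε)
    (L : ℝ) (hL : 0 ≤ L) (ε : ℝ) (hε : 0 < ε) :
    ∃ N : ℕ, ∀ i : ι,
      ∃ S : Finset (X i → ℂ), S.card ≤ N ∧
        (∀ s ∈ S, (Set.range s).Finite ∧ Measurable s) ∧
        ∀ f : C(X i, ℂ),
          (∀ x y : X i, dist (f x) (f y) ≤ L * dist x y) →
          (∀ x : X i, ‖f x‖ ≤ 1) →
          ∃ s ∈ S, ∀ x : X i, ‖f x - s x‖ ≤ ε := by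
  classical
  obtain ⟨t, htfin, ht⟩ := Metric.totallyBounded_iff.1
    (isCompact_closedBall (0 : ℂ) 1).totallyBounded (ε / 2) (half_pos hε)
  have hcover (z : ℂ) (hz : ‖z‖ ≤ 1) : ∃ d ∈ t, ‖z - d‖ ≤ ε / 2 := by
    obtain ⟨d, hd, hzd⟩ := Set.mem_iUnion₂.1 (ht (mem_closedBall_zero_iff.2 hz))
    exact ⟨d, hd, (mem_ball_iff_norm.1 hzd).le⟩
  lift t to Finset ℂ using htfin
  have hδ : 0 < ε / (4 * (L + 1)) := by positivity
  obtain ⟨N, hN⟩ := hadm _ hδ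
  refine ⟨t.card ^ (N + 1), fun i => ?_⟩
  obtain ⟨E, hEN, hE⟩ := hN i
  obtain ⟨p, hp, hpd⟩ := exists_measurable_fin_dist_le E hEN hE
  refine ⟨(Fintype.piFinset fun _ : Fin (N + 1) => t).image (fun c => c ∘ p), ?_, ?_, ?_⟩
  · exact Finset.card_image_le.trans (by simp)
  · simp only [Finset.mem_image]
    rintro _ ⟨c, -, rfl⟩
    exact ⟨(Set.finite_range c).subset (Set.range_comp_subset_range p c),
      (measurable_of_countable c).comp hp⟩
  · intro f hf hf1
    have hL1 : L * (2 * (ε / (4 * (L + 1)))) ≤ ε / 2 := by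
      have : L * (2 * (ε / (4 * (L + 1)))) = ε / 2 * (L / (L + 1)) := by field_simp; ring
      rw [this]
      exact mul_le_of_le_one_right (by positivity) (div_le_one_of_le₀ (by linarith) (by linarith))
    have hc (k : Fin (N + 1)) : ∃ d ∈ t, ∀ x, p x = k → ‖f x - d‖ ≤ ε := by
      by_cases h : ∃ y, p y = k
      · obtain ⟨y, rfl⟩ := h
        obtain ⟨d, hd, hyd⟩ := hcover (f y) (hf1 y)
        refine ⟨d, hd, fun x hxy => ?_⟩
        have hxy' : ‖f x - f y‖ ≤ ε / 2 := by
          rw [← dist_eq_norm]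
          exact ((hf x y).trans (mul_le_mul_of_nonneg_left (hpd x y hxy) hL)).trans hL1
        linarith [norm_sub_le_norm_sub_add_norm_sub (f x) (f y) d]
      · obtain ⟨d, hd, -⟩ := hcover 0 (by simp)
        exact ⟨d, hd, fun x hx => (h ⟨x, hx⟩).elim⟩
    choose c hct hc using hc
    exact ⟨c ∘ p, Finset.mem_image_of_mem _ (Fintype.mem_piFinset.2 hct), fun x => hc _ x rfl⟩
end

section
/- Let X be a compact metric space, let π : C(X) → B(H_π) and ρ : C(X) → B(H_ρ) be *-representations on complex Hilbert spaces, and let V : H_ρ → H_π be a linear isometry such that V* π(f) V − ρ(f) is a compact operator for every f ∈ C(X). Then V is automatically uniformly covering: for every ε > 0 and L ≥ 0 there exists M ∈ ℕ such that for every f ∈ C_L(X) there exists a bounded operator T on H_ρ of rank at most M with ‖V* π(f) V − ρ(f) − T‖ ≤ ε. -/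
/-- A compact operator into a Hilbert space is a norm limit of operators of finite rank. -/
theorem IsCompactOperator.exists_finite_rank_norm_sub_le {E F : Type*}
    [NormedAddCommGroup E] [NormedSpace ℂ E] [NormedAddCommGroup F] [InnerProductSpace ℂ F]
    {K : E →L[ℂ] F} (hK : IsCompactOperator K) {ε : ℝ} (hε : 0 < ε) :
    ∃ T : E →L[ℂ] F, LinearMap.rank (T : E →ₗ[ℂ] F) < Cardinal.aleph0 ∧ ‖K - T‖ ≤ ε := by
  obtain ⟨S, hS, hKS⟩ :=
    IsCompactOperator.image_closedBall_subset_compact (f := (K : E →ₗ[ℂ] F)) hK 1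
  obtain ⟨t, ht, hSt⟩ := Metric.totallyBounded_iff.1 hS.totallyBounded ε hε
  have : FiniteDimensional ℂ (Submodule.span ℂ t) := FiniteDimensional.span_of_finite ℂ ht
  set U := Submodule.span ℂ t
  refine ⟨U.starProjection.comp K, ?_, ?_⟩
  · refine lt_of_le_of_lt ?_ (Module.rank_lt_aleph0 ℂ U)
    refine Submodule.rank_mono ?_
    rintro _ ⟨x, rfl⟩
    exact U.starProjection_apply_mem (K x)
  · refine ContinuousLinearMap.opNorm_le_of_unit_norm (𝕜 := ℂ) hε.le fun x hx => ?_
    have hx' : K x ∈ S := hKS ⟨x, by simp [hx], rfl⟩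
    obtain ⟨z, hz, hxz⟩ := Set.mem_iUnion₂.1 (hSt hx')
    have hmin : ‖K x - U.starProjection (K x)‖ ≤ ‖K x - z‖ := by
      rw [U.starProjection_minimal]
      exact ciInf_le (f := fun u : U => ‖K x - u‖)
        ⟨0, Set.forall_mem_range.2 fun _ => norm_nonneg _⟩ ⟨z, Submodule.subset_span hz⟩
    rw [Metric.mem_ball, dist_eq_norm] at hxz
    exact hmin.trans hxz.le

/-- On a compact metric space, the uniformly bounded functions with a common Lipschitz constant
are totally bounded for the supremum norm. -/
theorem ContinuousMap.totallyBounded_setOf_lipschitz {X E : Type*} [MetricSpace X]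
    [CompactSpace X] [NormedAddCommGroup E] [ProperSpace E] (L C : ℝ) :
    TotallyBounded {f : C(X, E) |
      (∀ x y, dist (f x) (f y) ≤ L * dist x y) ∧ ∀ x, ‖f x‖ ≤ C} := by
  let e := ContinuousMap.isometryEquivBoundedOfCompact X E
  set A := {f : C(X, E) | (∀ x y, dist (f x) (f y) ≤ L * dist x y) ∧ ∀ x, ‖f x‖ ≤ C}
  have hequi : Equicontinuous ((↑) : (e '' A) → X → E) := by
    refine Metric.equicontinuous_of_continuity_modulus (fun r => L * r) ?_ _ ?_
    · simpa using (continuous_const_mul L).tendsto (0 : ℝ)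
    · rintro x y ⟨_, f, hf, rfl⟩
      exact hf.1 x y
  have hcompact : IsCompact (closure (e '' A)) := by
    refine BoundedContinuousFunction.arzela_ascoli (Metric.closedBall (0 : E) C)
      (isCompact_closedBall _ _) _ ?_ hequi
    rintro _ x ⟨f, hf, rfl⟩
    exact mem_closedBall_zero_iff.2 (hf.2 x)
  have himage : TotallyBounded (e.symm '' (e '' A)) :=
    (hcompact.totallyBounded.subset subset_closure).image e.symm.isometry.uniformContinuous
  simpa [Set.image_image] using himage

/-- If `φ` is uniformly continuous and takes values in the norm closure of the finite-rank
operators, then on a totally bounded set its values can be approximated by operators of uniformly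
bounded rank. -/
theorem TotallyBounded.exists_rank_le_forall_norm_sub_le {A E F : Type*} [PseudoMetricSpace A]
    [NormedAddCommGroup E] [NormedSpace ℂ E] [NormedAddCommGroup F] [NormedSpace ℂ F]
    {s : Set A} (hs : TotallyBounded s) {φ : A → E →L[ℂ] F} (hφ : UniformContinuous φ)
    (happrox : ∀ a, ∀ ε > 0, ∃ T : E →L[ℂ] F,
      LinearMap.rank (T : E →ₗ[ℂ] F) < Cardinal.aleph0 ∧ ‖φ a - T‖ ≤ ε)
    {ε : ℝ} (hε : 0 < ε) :
    ∃ M : ℕ, ∀ a ∈ s, ∃ T : E →L[ℂ] F,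
      LinearMap.rank (T : E →ₗ[ℂ] F) ≤ (M : Cardinal) ∧ ‖φ a - T‖ ≤ ε := by
  obtain ⟨δ, hδ, hφδ⟩ := Metric.uniformContinuous_iff.1 hφ (ε / 2) (half_pos hε)
  obtain ⟨t, ht, hst⟩ := Metric.totallyBounded_iff.1 hs δ hδ
  choose T hT hφT using fun a => happrox a (ε / 2) (half_pos hε)
  choose m hm using fun a => Cardinal.lt_aleph0.1 (hT a)
  obtain ⟨M, hM⟩ := (ht.image m).bddAbove
  refine ⟨M, fun a ha => ?_⟩
  obtain ⟨b, hb, hab⟩ := Set.mem_iUnion₂.1 (hst ha)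
  refine ⟨T b, ?_, ?_⟩
  · rw [hm b]
    exact_mod_cast hM ⟨b, hb, rfl⟩
  · have hdist := hφδ (Metric.mem_ball.1 hab)
    rw [dist_eq_norm] at hdist
    calc ‖φ a - T b‖ ≤ ‖φ a - φ b‖ + ‖φ b - T b‖ := norm_sub_le_norm_sub_add_norm_sub _ _ _
      _ ≤ ε / 2 + ε / 2 := add_le_add hdist.le (hφT b)
      _ = ε := add_halves ε

/-- For a compact metric space `X`, any isometry `V` that covers (i.e. such that
`V* π(f) V − ρ(f)` is compact for every `f ∈ C(X)`) is automatically uniformly covering: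
for every `ε > 0` and `L ≥ 0` there is a uniform rank bound `M` for `ε`-approximants of
`V* π(f) V − ρ(f)` over all `f ∈ C_L(X)`. -/
theorem covering_isometry_on_compact_is_uniformly_covering
    (X : Type) [MetricSpace X] [CompactSpace X]
    (Hπ Hρ : Type)
    [NormedAddCommGroup Hπ] [InnerProductSpace ℂ Hπ] [CompleteSpace Hπ]
    [NormedAddCommGroup Hρ] [InnerProductSpace ℂ Hρ] [CompleteSpace Hρ]
    (π : C(X, ℂ) →⋆ₐ[ℂ] (Hπ →L[ℂ] Hπ))
    (ρ : C(X, ℂ) →⋆ₐ[ℂ] (Hρ →L[ℂ] Hρ))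
    (V : Hρ →ₗᵢ[ℂ] Hπ)
    (hcpt : ∀ f : C(X, ℂ), IsCompactOperator
      ⇑((ContinuousLinearMap.adjoint V.toContinuousLinearMap).comp
          ((π f).comp V.toContinuousLinearMap) - ρ f)) :
    ∀ (ε : ℝ), 0 < ε → ∀ (L : ℝ), 0 ≤ L →
      ∃ M : ℕ, ∀ f : C(X, ℂ),
        (∀ x y : X, dist (f x) (f y) ≤ L * dist x y) →
        (∀ x : X, ‖f x‖ ≤ 1) →
        ∃ T : Hρ →L[ℂ] Hρ,
          LinearMap.rank (T : Hρ →ₗ[ℂ] Hρ) ≤ (M : Cardinal) ∧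
          ‖(ContinuousLinearMap.adjoint V.toContinuousLinearMap).comp
              ((π f).comp V.toContinuousLinearMap) - ρ f - T‖ ≤ ε := by
  intro ε hε L _
  have hπ : UniformContinuous π :=
    AddMonoidHomClass.uniformContinuous_of_bound π 1 fun f => by
      simpa using NonUnitalStarAlgHom.norm_apply_le π f
  have hρ : UniformContinuous ρ :=
    AddMonoidHomClass.uniformContinuous_of_bound ρ 1 fun f => by
      simpa using NonUnitalStarAlgHom.norm_apply_le ρ f
  let V' := V.toContinuousLinearMap
  have hcompress : UniformContinuous fun f =>
      (ContinuousLinearMap.adjoint V').comp ((π f).comp V') :=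
    (ContinuousLinearMap.postcomp Hρ (ContinuousLinearMap.adjoint V')).uniformContinuous.comp
      ((ContinuousLinearMap.precomp Hπ V').uniformContinuous.comp hπ)
  obtain ⟨M, hM⟩ :=
    (ContinuousMap.totallyBounded_setOf_lipschitz (X := X) (E := ℂ) L 1
      ).exists_rank_le_forall_norm_sub_le (hcompress.sub hρ)
      (fun f _ hδ => (hcpt f).exists_finite_rank_norm_sub_le hδ) hε
  exact ⟨M, fun f hL hf => hM f ⟨hL, hf⟩⟩
end
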